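/- For the Segre variety X = P² × P³ × P³, the 5-secant variety has dimension exactly 43 (one less than the expected dimension 44): for every choice of 5 points p₁,…,p₅ (pure tensors of nonzero vectors in K³ ⊗ K⁴ ⊗ K⁴), dim(T_{p₁} + T_{p₂} + T_{p₃} + T_{p₄} + T_{p₅}) ≤ 44, and there exists a choice of 5 such points for which this dimension equals 44. In particular T(2,3,3; 5; 0,0,0) fails (the expected value being min{5·9, 48} = 45). -/

import Mathlib

open scoped TensorProduct

/-- The subspace `G^i_p = v₁ ⊗ ⋯ ⊗ v_{i-1} ⊗ Vᵢ ⊗ v_{i+1} ⊗ ⋯ ⊗ v_k` of the tensor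
space `⨂ᵢ K^{nᵢ+1}` attached to the point `p = v₁ ⊗ ⋯ ⊗ v_k`. -/
noncomputable def segreG (K : Type*) [Field K] {k : ℕ} (n : Fin k → ℕ)
    (v : ∀ i, Fin (n i + 1) → K) (i : Fin k) :
    Submodule K (⨂[K] i, (Fin (n i + 1) → K)) :=
  LinearMap.range ((PiTensorProduct.tprod K).toLinearMap v i)

/-- The affine tangent space `T_p = Σᵢ v₁ ⊗ ⋯ ⊗ Vᵢ ⊗ ⋯ ⊗ v_k` to the Segre variety at
`p = v₁ ⊗ ⋯ ⊗ v_k`. -/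
noncomputable def segreTangent (K : Type*) [Field K] {k : ℕ} (n : Fin k → ℕ)
    (v : ∀ i, Fin (n i + 1) → K) : Submodule K (⨂[K] i, (Fin (n i + 1) → K)) :=
  ⨆ i, segreG K n v i

/-- The statement `T(n₁,…,n_k; s; a₁,…,a_k)` of Abo–Ottaviani–Peterson holds:
there are points `p₁,…,p_s` and `q_{i,1},…,q_{i,aᵢ}` (pure tensors of nonzero vectors)
such that the span of the tangent spaces `T_{p_j}` together with the subspaces
`G^i_{q_{i,l}}` has the expected (maximal possible) dimension
`min (s(1 + Σ nᵢ) + Σ aᵢ(nᵢ+1)) (Π (nᵢ+1))`. -/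
def THolds (K : Type*) [Field K] {k : ℕ} (n : Fin k → ℕ) (s : ℕ) (a : Fin k → ℕ) : Prop :=
  ∃ (p : Fin s → ∀ i, Fin (n i + 1) → K)
    (q : ∀ i : Fin k, Fin (a i) → ∀ j, Fin (n j + 1) → K),
    (∀ j i, p j i ≠ 0) ∧ (∀ i l j, q i l j ≠ 0) ∧
    Module.finrank K
      (((⨆ j, segreTangent K n (p j)) ⊔ (⨆ i, ⨆ l, segreG K n (q i l) i))
        : Submodule K (⨂[K] i, (Fin (n i + 1) → K)))
      = min (s * (1 + ∑ i, n i) + ∑ i, a i * (n i + 1)) (∏ i, (n i + 1))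

/-- The statement `T(n₁,…,n_k; s; a₁,…,a_k)` fails: every choice of points gives a span
of dimension strictly smaller than the expected dimension. -/
def TFails (K : Type*) [Field K] {k : ℕ} (n : Fin k → ℕ) (s : ℕ) (a : Fin k → ℕ) : Prop :=
  ∀ (p : Fin s → ∀ i, Fin (n i + 1) → K)
    (q : ∀ i : Fin k, Fin (a i) → ∀ j, Fin (n j + 1) → K),
    (∀ j i, p j i ≠ 0) → (∀ i l j, q i l j ≠ 0) →
    Module.finrank K
      (((⨆ j, segreTangent K n (p j)) ⊔ (⨆ i, ⨆ l, segreG K n (q i l) i))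
        : Submodule K (⨂[K] i, (Fin (n i + 1) → K)))
      < min (s * (1 + ∑ i, n i) + ∑ i, a i * (n i + 1)) (∏ i, (n i + 1))

/-- The tuple `(n; s; a)` is subabundant. -/
def Subabundant {k : ℕ} (n : Fin k → ℕ) (s : ℕ) (a : Fin k → ℕ) : Prop :=
  s * (1 + ∑ i, n i) + ∑ i, a i * (n i + 1) ≤ ∏ i, (n i + 1)

/-- The tuple `(n; s; a)` is superabundant. -/
def Superabundant {k : ℕ} (n : Fin k → ℕ) (s : ℕ) (a : Fin k → ℕ) : Prop :=
  ∏ i, (n i + 1) ≤ s * (1 + ∑ i, n i) + ∑ i, a i * (n i + 1)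

section Secant

open Module

section Dimension

variable {K V : Type*} [Field K] [AddCommGroup V] [Module K V] [FiniteDimensional K V]

lemma finrank_finset_sup_le {ι : Type*} (s : Finset ι) (f : ι → Submodule K V) :
    finrank K (s.sup f : Submodule K V) ≤ ∑ i ∈ s, finrank K (f i) := by
  classical
  induction s using Finset.induction_on with
  | empty => simp
  | insert i s hi ih =>
    rw [Finset.sup_insert, Finset.sum_insert hi]
    exact (Submodule.finrank_add_le_finrank_add_finrank _ _).trans (by gcongr)

lemma finrank_sup_lt_of_inf_ne_bot {S T : Submodule K V} {v : V} (hS : v ∈ S) (hT : v ∈ T)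
    (hv : v ≠ 0) : finrank K (S ⊔ T : Submodule K V) + 1 ≤ finrank K S + finrank K T := by
  rw [← Submodule.finrank_sup_add_finrank_inf_eq]
  gcongr
  exact Submodule.one_le_finrank_iff.mpr fun h => hv <| (Submodule.eq_bot_iff _).mp h v ⟨hS, hT⟩

omit [FiniteDimensional K V] in
lemma exists_linearIndependent_mem_of_le_finrank {S : Submodule K V} {n : ℕ}
    (hn : n ≤ finrank K S) : ∃ u : Fin n → V, LinearIndependent K u ∧ ∀ i, u i ∈ S := by
  obtain ⟨u, hu⟩ := exists_linearIndependent_of_le_finrank hn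
  exact ⟨fun i => u i, hu.map' S.subtype S.ker_subtype, fun i => (u i).2⟩

lemma finrank_le_finrank_map_add_finrank_inf_ker {W : Type*} [AddCommGroup W] [Module K W]
    (f : V →ₗ[K] W) (S : Submodule K V) :
    finrank K S ≤ finrank K (S.map f) + finrank K (S ⊓ LinearMap.ker f : Submodule K V) := by
  rw [← (f.domRestrict S).finrank_range_add_finrank_ker, LinearMap.range_domRestrict]
  gcongr
  rw [LinearMap.ker_domRestrict, ← Submodule.finrank_map_subtype_eq, Submodule.map_comap_subtype]

end Dimension

section Tangent

variable {K A B C : Type*} [Field K] [AddCommGroup A] [Module K A] [AddCommGroup B] [Module K B]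
  [AddCommGroup C] [Module K C]

/-- The affine tangent space to the Segre variety at `a ⊗ b ⊗ c`. -/
def tripleTangent (a : A) (b : B) (c : C) : Submodule K (A ⊗[K] (B ⊗[K] C)) :=
  LinearMap.range ((TensorProduct.mk K A (B ⊗[K] C)).flip (b ⊗ₜ c)) ⊔
    LinearMap.range (TensorProduct.mk K A (B ⊗[K] C) a ∘ₗ (TensorProduct.mk K B C).flip c) ⊔
    LinearMap.range (TensorProduct.mk K A (B ⊗[K] C) a ∘ₗ TensorProduct.mk K B C b)

lemma tripleTangent_le_iff {a : A} {b : B} {c : C} {S : Submodule K (A ⊗[K] (B ⊗[K] C))} :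
    tripleTangent a b c ≤ S ↔ (∀ x, x ⊗ₜ (b ⊗ₜ c) ∈ S) ∧ (∀ y, a ⊗ₜ (y ⊗ₜ c) ∈ S) ∧
      ∀ z, a ⊗ₜ (b ⊗ₜ z) ∈ S := by
  simp [tripleTangent, LinearMap.range_le_iff_comap, Submodule.eq_top_iff', and_assoc]

lemma tmul_mem_tripleTangent_left (a : A) (b : B) (c : C) (x : A) :
    x ⊗ₜ (b ⊗ₜ c) ∈ tripleTangent (K := K) a b c := (tripleTangent_le_iff.mp le_rfl).1 x

lemma tmul_mem_tripleTangent_mid (a : A) (b : B) (c : C) (y : B) :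
    a ⊗ₜ (y ⊗ₜ c) ∈ tripleTangent (K := K) a b c := (tripleTangent_le_iff.mp le_rfl).2.1 y

lemma tmul_mem_tripleTangent_right (a : A) (b : B) (c : C) (z : C) :
    a ⊗ₜ (b ⊗ₜ z) ∈ tripleTangent (K := K) a b c := (tripleTangent_le_iff.mp le_rfl).2.2 z

lemma tmul_tmul_ne_zero {a : A} {b : B} {c : C} (ha : a ≠ 0) (hb : b ≠ 0) (hc : c ≠ 0) :
    a ⊗ₜ[K] (b ⊗ₜ[K] c) ≠ 0 := by
  obtain ⟨f, hf⟩ : ∃ f : Dual K A, f a ≠ 0 := by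
    simpa using mt (forall_dual_apply_eq_zero_iff K a).mp ha
  obtain ⟨g, hg⟩ : ∃ g : Dual K B, g b ≠ 0 := by
    simpa using mt (forall_dual_apply_eq_zero_iff K b).mp hb
  obtain ⟨h, hh⟩ : ∃ h : Dual K C, h c ≠ 0 := by
    simpa using mt (forall_dual_apply_eq_zero_iff K c).mp hc
  intro h0
  have := congrArg (TensorProduct.lift (LinearMap.mul K K) ∘ₗ
    TensorProduct.map f (TensorProduct.lift (LinearMap.mul K K) ∘ₗ TensorProduct.map g h)) h0
  simp [hf, hg, hh] at this

variable [FiniteDimensional K A] [FiniteDimensional K B] [FiniteDimensional K C]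

lemma finrank_tripleTangent_add_two_le {a : A} {b : B} {c : C} (ha : a ≠ 0) (hb : b ≠ 0)
    (hc : c ≠ 0) :
    finrank K (tripleTangent (K := K) a b c) + 2 ≤ finrank K A + finrank K B + finrank K C := by
  have h := tmul_tmul_ne_zero (K := K) ha hb hc
  have h₁ := finrank_sup_lt_of_inf_ne_bot
    (S := LinearMap.range ((TensorProduct.mk K A (B ⊗[K] C)).flip (b ⊗ₜ c)))
    (T := LinearMap.range (TensorProduct.mk K A (B ⊗[K] C) a ∘ₗ (TensorProduct.mk K B C).flip c))
    ⟨a, rfl⟩ ⟨b, rfl⟩ h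
  have h₂ := finrank_sup_lt_of_inf_ne_bot
    (S := LinearMap.range ((TensorProduct.mk K A (B ⊗[K] C)).flip (b ⊗ₜ c)) ⊔
      LinearMap.range (TensorProduct.mk K A (B ⊗[K] C) a ∘ₗ (TensorProduct.mk K B C).flip c))
    (T := LinearMap.range (TensorProduct.mk K A (B ⊗[K] C) a ∘ₗ TensorProduct.mk K B C b))
    (Submodule.mem_sup_left ⟨a, rfl⟩) ⟨c, rfl⟩ h
  have h₃ := ((TensorProduct.mk K A (B ⊗[K] C)).flip (b ⊗ₜ c)).finrank_range_le
  have h₄ := (TensorProduct.mk K A (B ⊗[K] C) a ∘ₗ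
    (TensorProduct.mk K B C).flip c).finrank_range_le
  have h₅ := (TensorProduct.mk K A (B ⊗[K] C) a ∘ₗ TensorProduct.mk K B C b).finrank_range_le
  rw [tripleTangent]
  omega

end Tangent

section Contraction

variable {K A B C : Type*} [Field K] [AddCommGroup A] [Module K A] [AddCommGroup B] [Module K B]
  [AddCommGroup C] [Module K C]

/-- Contraction of the middle factor of `A ⊗ B ⊗ C` with a linear form. -/
noncomputable def contractMid (A C : Type*) [AddCommGroup A] [Module K A] [AddCommGroup C]
    [Module K C] (β : Dual K B) : A ⊗[K] (B ⊗[K] C) →ₗ[K] A ⊗[K] C :=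
  (TensorProduct.lid K C ∘ₗ β.rTensor C).lTensor A

/-- Contraction of the last factor of `A ⊗ B ⊗ C` with a linear form. -/
noncomputable def contractLast (A B : Type*) [AddCommGroup A] [Module K A] [AddCommGroup B]
    [Module K B] (γ : Dual K C) : A ⊗[K] (B ⊗[K] C) →ₗ[K] A ⊗[K] B :=
  (TensorProduct.rid K B ∘ₗ γ.lTensor B).lTensor A

@[simp]
lemma contractMid_tmul (β : Dual K B) (a : A) (b : B) (c : C) :
    contractMid A C β (a ⊗ₜ (b ⊗ₜ c)) = β b • a ⊗ₜ[K] c := by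
  simp [contractMid]

@[simp]
lemma contractLast_tmul (γ : Dual K C) (a : A) (b : B) (c : C) :
    contractLast A B γ (a ⊗ₜ (b ⊗ₜ c)) = γ c • a ⊗ₜ[K] b := by
  simp [contractLast]

/-- The projection onto the kernel of `β` along `e`, when `β e = 1`. -/
def kerProj (β : Dual K B) {e : B} (he : β e = 1) : B →ₗ[K] LinearMap.ker β :=
  (LinearMap.id - β.smulRight e).codRestrict _ fun x => by simp [he]

@[simp]
lemma coe_kerProj (β : Dual K B) {e : B} (he : β e = 1) (x : B) :
    (kerProj β he x : B) = x - β x • e := rfl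

lemma finrank_map_contractMid_le {ι : Type*} (s : Finset ι) {a : ι → A} {b : ι → B} {c : ι → C}
    {β : Dual K B} (hβ : ∀ i ∈ s, β (b i) = 0) :
    finrank K ((s.sup fun i => tripleTangent (a i) (b i) (c i)).map (contractMid A C β))
      ≤ s.card := by
  classical
  have hle : (s.sup fun i => tripleTangent (a i) (b i) (c i)).map (contractMid A C β) ≤
      Submodule.span K (s.image fun i => a i ⊗ₜ[K] c i : Finset (A ⊗[K] C)) := by
    rw [Submodule.map_le_iff_le_comap, Finset.sup_le_iff]
    intro i hi
    have h : a i ⊗ₜ[K] c i ∈ Submodule.span K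
        (s.image fun i => a i ⊗ₜ[K] c i : Finset (A ⊗[K] C)) :=
      Submodule.subset_span (by simpa using ⟨i, hi, rfl⟩)
    simpa [tripleTangent_le_iff, hβ i hi] using fun y => Submodule.smul_mem _ (β y) h
  exact (Submodule.finrank_mono hle).trans
    ((finrank_span_finset_le_card _).trans Finset.card_image_le)

lemma finrank_map_contractLast_le {ι : Type*} (s : Finset ι) {a : ι → A} {b : ι → B} {c : ι → C}
    {γ : Dual K C} (hγ : ∀ i ∈ s, γ (c i) = 0) :
    finrank K ((s.sup fun i => tripleTangent (a i) (b i) (c i)).map (contractLast A B γ))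
      ≤ s.card := by
  classical
  have hle : (s.sup fun i => tripleTangent (a i) (b i) (c i)).map (contractLast A B γ) ≤
      Submodule.span K (s.image fun i => a i ⊗ₜ[K] b i : Finset (A ⊗[K] B)) := by
    rw [Submodule.map_le_iff_le_comap, Finset.sup_le_iff]
    intro i hi
    have h : a i ⊗ₜ[K] b i ∈ Submodule.span K
        (s.image fun i => a i ⊗ₜ[K] b i : Finset (A ⊗[K] B)) :=
      Submodule.subset_span (by simpa using ⟨i, hi, rfl⟩)
    simpa [tripleTangent_le_iff, hγ i hi] using fun z => Submodule.smul_mem _ (γ z) h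
  exact (Submodule.finrank_mono hle).trans
    ((finrank_span_finset_le_card _).trans Finset.card_image_le)

variable [FiniteDimensional K A] [FiniteDimensional K B] [FiniteDimensional K C]

lemma finrank_ker_contractMid {β : Dual K B} (hβ : β ≠ 0) :
    finrank K (LinearMap.ker (contractMid A C β)) + finrank K A * finrank K C =
      finrank K A * (finrank K B * finrank K C) := by
  have hs : Function.Surjective (contractMid A C β) := by
    refine LinearMap.lTensor_surjective A ?_
    exact (TensorProduct.lid K C).surjective.comp
      (LinearMap.rTensor_surjective C (LinearMap.surjective hβ))
  have := (contractMid A C β).finrank_range_add_finrank_ker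
  rw [LinearMap.range_eq_top.mpr hs, finrank_top] at this
  simp only [finrank_tensorProduct] at this
  omega

lemma finrank_ker_contractLast {γ : Dual K C} (hγ : γ ≠ 0) :
    finrank K (LinearMap.ker (contractLast A B γ)) + finrank K A * finrank K B =
      finrank K A * (finrank K B * finrank K C) := by
  have hs : Function.Surjective (contractLast A B γ) := by
    refine LinearMap.lTensor_surjective A ?_
    exact (TensorProduct.rid K B).surjective.comp
      (LinearMap.lTensor_surjective B (LinearMap.surjective hγ))
  have := (contractLast A B γ).finrank_range_add_finrank_ker
  rw [LinearMap.range_eq_top.mpr hs, finrank_top] at this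
  simp only [finrank_tensorProduct] at this
  omega

lemma finrank_ker_contractMid_inf_ker_contractLast_le {β : Dual K B} {γ : Dual K C} (hβ : β ≠ 0)
    (hγ : γ ≠ 0) :
    finrank K (LinearMap.ker (contractMid A C β) ⊓ LinearMap.ker (contractLast A B γ) :
      Submodule K (A ⊗[K] (B ⊗[K] C))) ≤
      finrank K A * ((finrank K B - 1) * (finrank K C - 1)) := by
  obtain ⟨e, he⟩ := LinearMap.surjective hβ 1
  obtain ⟨f, hf⟩ := LinearMap.surjective hγ 1
  have hB := Dual.finrank_ker_add_one_of_ne_zero hβ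
  have hC := Dual.finrank_ker_add_one_of_ne_zero hγ
  let ι := ((LinearMap.ker β).subtype.rTensor (LinearMap.ker γ)).lTensor A
  let κ := ((LinearMap.ker γ).subtype.lTensor B).lTensor A
  rw [← hB, ← hC, Nat.add_sub_cancel, Nat.add_sub_cancel, ← finrank_tensorProduct (R := K),
    ← finrank_tensorProduct (R := K)]
  refine (Submodule.finrank_mono ?_).trans (κ ∘ₗ ι).finrank_range_le
  rintro X ⟨hX₁, hX₂⟩
  let p : A ⊗[K] (B ⊗[K] C) →ₗ[K] A ⊗[K] (B ⊗[K] C) :=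
    (((LinearMap.ker β).subtype ∘ₗ kerProj β he).rTensor C).lTensor A
  let q : A ⊗[K] (B ⊗[K] C) →ₗ[K] A ⊗[K] (B ⊗[K] C) :=
    (((LinearMap.ker γ).subtype ∘ₗ kerProj γ hf).lTensor B).lTensor A
  have hp : p X = X := by
    have : p = LinearMap.id - (TensorProduct.mk K B C e).lTensor A ∘ₗ contractMid A C β := by
      ext a b c
      simp [p, TensorProduct.sub_tmul, TensorProduct.tmul_sub, TensorProduct.smul_tmul]
    simp [this, LinearMap.mem_ker.mp hX₁]
  have hq : q X = X := by
    have : q = LinearMap.id -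
        ((TensorProduct.mk K B C).flip f).lTensor A ∘ₗ contractLast A B γ := by
      ext a b c
      simp [q, TensorProduct.tmul_sub]
    simp [this, LinearMap.mem_ker.mp hX₂]
  have hpq : κ ∘ₗ ι ∘ₗ (TensorProduct.map (kerProj β he) (kerProj γ hf)).lTensor A = q ∘ₗ p := by
    ext a b c
    simp [κ, ι, p, q]
  refine ⟨(TensorProduct.map (kerProj β he) (kerProj γ hf)).lTensor A X, ?_⟩
  have := LinearMap.congr_fun hpq X
  simpa only [LinearMap.comp_apply, hp, hq] using this

end Contraction

section SpecialPosition

variable {K A B C ι : Type*} [Field K] [AddCommGroup A] [Module K A] [AddCommGroup B] [Module K B]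
  [AddCommGroup C] [Module K C] [FiniteDimensional K A] [FiniteDimensional K B]
  [FiniteDimensional K C]

lemma finrank_sup_tripleTangent_le_of_forall_apply_eq_zero (s : Finset ι) {a : ι → A} {b : ι → B}
    {c : ι → C} {β : Dual K B} (hβ : β ≠ 0) (hb : ∀ i ∈ s, β (b i) = 0) :
    finrank K (s.sup fun i => tripleTangent (a i) (b i) (c i) :
      Submodule K (A ⊗[K] (B ⊗[K] C))) + finrank K A * finrank K C ≤
      s.card + finrank K A * (finrank K B * finrank K C) := by
  have h₁ := finrank_le_finrank_map_add_finrank_inf_ker (contractMid A C β)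
    (s.sup fun i => tripleTangent (a i) (b i) (c i))
  have h₂ := finrank_map_contractMid_le s (a := a) (c := c) hb
  have h₃ := Submodule.finrank_mono (inf_le_right : (s.sup fun i => tripleTangent (a i) (b i) (c i))
    ⊓ LinearMap.ker (contractMid A C β) ≤ _)
  have h₄ := finrank_ker_contractMid (A := A) (C := C) hβ
  omega

lemma finrank_sup_tripleTangent_le_of_forall_apply_eq_zero' (s : Finset ι) {a : ι → A} {b : ι → B}
    {c : ι → C} {γ : Dual K C} (hγ : γ ≠ 0) (hc : ∀ i ∈ s, γ (c i) = 0) :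
    finrank K (s.sup fun i => tripleTangent (a i) (b i) (c i) :
      Submodule K (A ⊗[K] (B ⊗[K] C))) + finrank K A * finrank K B ≤
      s.card + finrank K A * (finrank K B * finrank K C) := by
  have h₁ := finrank_le_finrank_map_add_finrank_inf_ker (contractLast A B γ)
    (s.sup fun i => tripleTangent (a i) (b i) (c i))
  have h₂ := finrank_map_contractLast_le s (a := a) (b := b) hc
  have h₃ := Submodule.finrank_mono (inf_le_right : (s.sup fun i => tripleTangent (a i) (b i) (c i))
    ⊓ LinearMap.ker (contractLast A B γ) ≤ _)
  have h₄ := finrank_ker_contractLast (A := A) (B := B) hγ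
  omega

lemma finrank_sup_tripleTangent_le_of_forall_apply_eq_zero_both (s : Finset ι) {a : ι → A}
    {b : ι → B} {c : ι → C} {β : Dual K B} {γ : Dual K C} (hβ : β ≠ 0) (hγ : γ ≠ 0)
    (hb : ∀ i ∈ s, β (b i) = 0) (hc : ∀ i ∈ s, γ (c i) = 0) :
    finrank K (s.sup fun i => tripleTangent (a i) (b i) (c i) :
      Submodule K (A ⊗[K] (B ⊗[K] C))) ≤
      2 * s.card + finrank K A * ((finrank K B - 1) * (finrank K C - 1)) := by
  set S := s.sup fun i => tripleTangent (K := K) (a i) (b i) (c i) with hS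
  have h₁ := finrank_le_finrank_map_add_finrank_inf_ker (contractMid A C β) S
  have h₂ := finrank_le_finrank_map_add_finrank_inf_ker (contractLast A B γ)
    (S ⊓ LinearMap.ker (contractMid A C β))
  have h₃ := finrank_map_contractMid_le s (a := a) (c := c) hb
  have h₄ := finrank_map_contractLast_le s (a := a) (b := b) hc
  have h₅ := Submodule.finrank_mono (Submodule.map_mono (f := contractLast A B γ)
    (inf_le_left : S ⊓ LinearMap.ker (contractMid A C β) ≤ S))
  have h₆ := Submodule.finrank_mono (inf_le_inf_right (LinearMap.ker (contractLast A B γ))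
    (inf_le_right : S ⊓ LinearMap.ker (contractMid A C β) ≤ _))
  have h₇ := finrank_ker_contractMid_inf_ker_contractLast_le (A := A) hβ hγ
  rw [← hS] at h₃ h₄
  omega

end SpecialPosition

section FivePoints

variable {K B C : Type*} [Field K] [AddCommGroup B] [Module K B] [AddCommGroup C] [Module K C]

/-- Given five points `a i` of a three-dimensional space and five points `b i` spanning a
four-dimensional space, there is a pencil of linear maps sending every `b i` to a multiple
of `a i`. -/
lemma exists_pencil [FiniteDimensional K B] {a : Fin 5 → Fin 3 → K} {b : Fin 5 → B}
    (hB : finrank K B = 4) (hb : ∀ β : Dual K B, (∀ i, β (b i) = 0) → β = 0) :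
    ∃ (k : Fin 2 → B →ₗ[K] Fin 3 → K) (κ : Fin 2 → Fin 5 → K),
      (∀ r i, k r (b i) = κ r i • a i) ∧
      ∀ x : Fin 2 → K, x ≠ 0 → ∃ i, ∑ r, x r * κ r i ≠ 0 := by
  obtain ⟨L, hL⟩ : ∃ L : (B →ₗ[K] Fin 3 → K) × (Fin 5 → K) →ₗ[K] Fin 5 → Fin 3 → K,
      ∀ w i, L w i = w.1 (b i) - w.2 i • a i :=
    ⟨LinearMap.pi fun i => LinearMap.applyₗ (b i) ∘ₗ LinearMap.fst K _ _ -
      (LinearMap.proj i ∘ₗ LinearMap.snd K _ _).smulRight (a i), fun _ _ => rfl⟩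
  have hker : 2 ≤ finrank K (LinearMap.ker L) := by
    have h₁ := L.finrank_range_add_finrank_ker
    have h₂ := (LinearMap.range L).finrank_le
    simp only [finrank_prod, finrank_linearMap, finrank_pi, finrank_pi_fintype, hB,
      Finset.sum_const, Finset.card_univ, Fintype.card_fin, smul_eq_mul] at h₁ h₂
    omega
  obtain ⟨u, hu, huL⟩ := exists_linearIndependent_mem_of_le_finrank hker
  have key : ∀ r i, (u r).1 (b i) = (u r).2 i • a i := by
    intro r i
    have := congrFun (LinearMap.mem_ker.mp (huL r)) i
    rwa [hL, Pi.zero_apply, sub_eq_zero] at this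
  refine ⟨fun r => (u r).1, fun r => (u r).2, key, fun x hx => ?_⟩
  by_contra! h
  refine hx (funext (Fintype.linearIndependent_iff.mp hu x (Prod.ext ?_ ?_)))
  · have hz : ∀ i, (∑ r, x r • (u r).1) (b i) = 0 := fun i => by
      simp only [LinearMap.sum_apply, LinearMap.smul_apply, key, smul_smul, ← Finset.sum_smul, h,
        zero_smul]
    simp only [Prod.fst_sum, Prod.smul_fst,
      Prod.fst_zero]
    ext y m
    exact LinearMap.congr_fun (hb (LinearMap.proj m ∘ₗ ∑ r, x r • (u r).1)
      fun i => by rw [LinearMap.comp_apply, hz, map_zero]) y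
  · ext i
    simpa only [Prod.snd_sum, Prod.smul_snd,
      Prod.snd_zero, Pi.zero_apply,
      Finset.sum_apply, Pi.smul_apply, smul_eq_mul] using h i

/-- The linear form `a ⊗ b ⊗ c ↦ det (a, k b, l c)`. -/
noncomputable def tripleForm (k : B →ₗ[K] Fin 3 → K) (l : C →ₗ[K] Fin 3 → K) :
    Dual K ((Fin 3 → K) ⊗[K] (B ⊗[K] C)) :=
  TensorProduct.lift ((dotProductBilin K K).compl₂
    (TensorProduct.lift (crossProduct.compl₁₂ k l)))

open Matrix in
@[simp]
lemma tripleForm_tmul (k : B →ₗ[K] Fin 3 → K) (l : C →ₗ[K] Fin 3 → K) (a : Fin 3 → K) (b : B)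
    (c : C) : tripleForm k l (a ⊗ₜ (b ⊗ₜ c)) = a ⬝ᵥ (k b ⨯₃ l c) := by
  simp [tripleForm]

lemma tripleForm_mem_dualAnnihilator {a : Fin 3 → K} {b : B} {c : C} {k : B →ₗ[K] Fin 3 → K}
    {l : C →ₗ[K] Fin 3 → K} {x y : K} (hk : k b = x • a) (hl : l c = y • a) :
    tripleForm k l ∈ (tripleTangent a b c).dualAnnihilator := by
  rw [Submodule.mem_dualAnnihilator]
  change tripleTangent a b c ≤ LinearMap.ker (tripleForm k l)
  simp [tripleTangent_le_iff, hk, hl]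

open Matrix in
lemma exists_dotProduct_cross_ne_zero {v w : Fin 3 → K} (h : v ⨯₃ w ≠ 0) :
    ∃ a : Fin 3 → K, a ⬝ᵥ (v ⨯₃ w) ≠ 0 := by
  by_contra! h'
  exact h (dotProduct_eq_zero _ fun a => by rw [dotProduct_comm, h'])

lemma exists_hyperplane_of_pencil {ι : Type*} {a : ι → Fin 3 → K} {b : ι → B}
    {k : Fin 2 → B →ₗ[K] Fin 3 → K} {κ : Fin 2 → ι → K} (hk : ∀ r i, k r (b i) = κ r i • a i)
    {x : Fin 2 → K} {i : ι} (ha : a i ≠ 0) (hi : ∑ r, x r * κ r i ≠ 0)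
    (hj : ∀ j ≠ i, ∑ r, x r * κ r j = 0) :
    ∃ β : Dual K B, β ≠ 0 ∧ ∀ j ≠ i, β (b j) = 0 := by
  have hx : ∀ j, (∑ r, x r • k r) (b j) = (∑ r, x r * κ r j) • a j := fun j => by
    simp only [LinearMap.sum_apply, LinearMap.smul_apply, hk, Finset.sum_smul, mul_smul]
  obtain ⟨t, ht⟩ := Function.ne_iff.mp ha
  refine ⟨LinearMap.proj t ∘ₗ ∑ r, x r • k r, fun h0 => ?_, fun j hji => ?_⟩
  · have := LinearMap.congr_fun h0 (b i)
    rw [LinearMap.comp_apply, hx, map_smul] at this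
    exact (smul_ne_zero hi ht) this
  · rw [LinearMap.comp_apply, hx, hj j hji, zero_smul, map_zero]

/-- If the forms attached to two pencils are linearly dependent, then for some `i` the points
`b j`, `j ≠ i`, lie in a hyperplane, and so do the points `c j`, `j ≠ i`. -/
lemma exists_hyperplanes_of_not_linearIndependent {a : Fin 5 → Fin 3 → K} {b : Fin 5 → B}
    {c : Fin 5 → C} (ha : ∀ i, a i ≠ 0) (hcross : ∀ i j, i ≠ j → crossProduct (a i) (a j) ≠ 0)
    {k : Fin 2 → B →ₗ[K] Fin 3 → K} {κ : Fin 2 → Fin 5 → K}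
    {l : Fin 2 → C →ₗ[K] Fin 3 → K} {μ : Fin 2 → Fin 5 → K}
    (hk : ∀ r i, k r (b i) = κ r i • a i) (hl : ∀ r i, l r (c i) = μ r i • a i)
    (hκ : ∀ x : Fin 2 → K, x ≠ 0 → ∃ i, ∑ r, x r * κ r i ≠ 0)
    (hμ : ∀ x : Fin 2 → K, x ≠ 0 → ∃ i, ∑ r, x r * μ r i ≠ 0)
    (h : ¬ LinearIndependent K fun rs : Fin 2 × Fin 2 => tripleForm (k rs.1) (l rs.2)) :
    ∃ i, ∃ β : Dual K B, ∃ γ : Dual K C, β ≠ 0 ∧ γ ≠ 0 ∧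
      ∀ j, j ≠ i → β (b j) = 0 ∧ γ (c j) = 0 := by
  rw [Fintype.linearIndependent_iff] at h
  push Not at h
  obtain ⟨g, hg, ⟨r₀, s₀⟩, hg₀⟩ := h
  have hzero : ∀ i j, i ≠ j → ∑ r, ∑ s, g (r, s) * κ r i * μ s j = 0 := by
    intro i j hij
    obtain ⟨x, hx⟩ := exists_dotProduct_cross_ne_zero (hcross i j hij)
    have := LinearMap.congr_fun hg (x ⊗ₜ (b i ⊗ₜ c j))
    simp only [LinearMap.sum_apply, LinearMap.smul_apply, tripleForm_tmul, hk, hl, map_smul,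
      LinearMap.smul_apply, dotProduct_smul, smul_eq_mul, LinearMap.zero_apply,
      Fintype.sum_prod_type] at this
    refine (mul_eq_zero.mp (?_ : _ * (x ⬝ᵥ crossProduct (a i) (a j)) = 0)).resolve_right hx
    rw [← this]
    simp only [Finset.sum_mul]
    exact Finset.sum_congr rfl fun r _ => Finset.sum_congr rfl fun s _ => by ring
  obtain ⟨i, hi⟩ := hκ (fun r => g (r, s₀)) fun h0 => hg₀ (congrFun h0 r₀)
  have hvz : ∀ j ≠ i, ∑ s, (∑ r, g (r, s) * κ r i) * μ s j = 0 := fun j hj => by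
    rw [← hzero i j hj.symm, Finset.sum_comm]
    simp only [Finset.sum_mul]
  obtain ⟨j, hj⟩ := hμ (fun s => ∑ r, g (r, s) * κ r i) fun h0 => hi (congrFun h0 s₀)
  obtain rfl : j = i := by
    by_contra hji
    exact hj (hvz j hji)
  have hw : ∀ m, ∑ r, (∑ s, g (r, s) * μ s j) * κ r m = ∑ r, ∑ s, g (r, s) * κ r m * μ s j :=
    fun m => Finset.sum_congr rfl fun r _ => by
      rw [Finset.sum_mul]
      exact Finset.sum_congr rfl fun s _ => by ring
  obtain ⟨γ, hγ, hγc⟩ := exists_hyperplane_of_pencil hl (ha j) hj hvz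
  obtain ⟨β, hβ, hβb⟩ := exists_hyperplane_of_pencil (x := fun r => ∑ s, g (r, s) * μ s j) hk
    (ha j) (by
      rw [hw, Finset.sum_comm]
      simpa only [Finset.sum_mul] using hj)
    (fun m hm => by rw [hw, hzero m j hm])
  exact ⟨j, β, γ, hβ, hγ, fun m hm => ⟨hβb m hm, hγc m hm⟩⟩

variable [FiniteDimensional K B] [FiniteDimensional K C]

/-- Five tangent spaces to the Segre variety `P² × P³ × P³` never span a space of dimension
greater than `44`. -/
lemma finrank_sup_tripleTangent_le {a : Fin 5 → Fin 3 → K} {b : Fin 5 → B} {c : Fin 5 → C}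
    (hB : finrank K B = 4) (hC : finrank K C = 4) (ha : ∀ i, a i ≠ 0) (hb : ∀ i, b i ≠ 0)
    (hc : ∀ i, c i ≠ 0) :
    finrank K (Finset.univ.sup fun i => tripleTangent (a i) (b i) (c i) :
      Submodule K ((Fin 3 → K) ⊗[K] (B ⊗[K] C))) ≤ 44 := by
  have hA : finrank K (Fin 3 → K) = 3 := by simp
  have h9 : ∀ i, finrank K (tripleTangent (K := K) (a i) (b i) (c i)) ≤ 9 := fun i => by
    have := finrank_tripleTangent_add_two_le (K := K) (ha i) (hb i) (hc i)
    omega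
  have hsum : ∀ s : Finset (Fin 5), finrank K (s.sup fun i => tripleTangent (a i) (b i) (c i) :
      Submodule K ((Fin 3 → K) ⊗[K] (B ⊗[K] C))) ≤ s.card * 9 := fun s =>
    (finrank_finset_sup_le s _).trans (Finset.sum_le_card_nsmul s _ 9 fun i _ => h9 i)
  by_cases hbs : ∀ β : Dual K B, (∀ i, β (b i) = 0) → β = 0
  swap
  · push Not at hbs
    obtain ⟨β, hβb, hβ⟩ := hbs
    have := finrank_sup_tripleTangent_le_of_forall_apply_eq_zero Finset.univ (a := a) (c := c) hβ
      fun i _ => hβb i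
    simp only [hA, hB, hC, Finset.card_univ, Fintype.card_fin] at this
    omega
  by_cases hcs : ∀ γ : Dual K C, (∀ i, γ (c i) = 0) → γ = 0
  swap
  · push Not at hcs
    obtain ⟨γ, hγc, hγ⟩ := hcs
    have := finrank_sup_tripleTangent_le_of_forall_apply_eq_zero' Finset.univ (a := a) (b := b) hγ
      fun i _ => hγc i
    simp only [hA, hB, hC, Finset.card_univ, Fintype.card_fin] at this
    omega
  by_cases hcross : ∀ i j, i ≠ j → crossProduct (a i) (a j) ≠ 0
  swap
  · push Not at hcross
    obtain ⟨i, j, hij, hcr⟩ := hcross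
    obtain ⟨t, ht⟩ : ∃ t : K, t • a i = a j := by
      have := mt crossProduct_ne_zero_iff_linearIndependent.mpr (not_not.mpr hcr)
      simpa [LinearIndependent.pair_iff' (ha i)] using this
    have hpair := finrank_sup_lt_of_inf_ne_bot
      (tmul_mem_tripleTangent_right (K := K) (a i) (b i) (c i) (c j))
      (v := a i ⊗ₜ (b i ⊗ₜ c j)) (T := tripleTangent (a j) (b j) (c j))
      (by
        have ht0 : t ≠ 0 := by
          rintro rfl
          exact ha j (by simpa using ht.symm)
        have := Submodule.smul_mem _ t⁻¹
          (tmul_mem_tripleTangent_mid (K := K) (a j) (b j) (c j) (b i))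
        rwa [← ht, TensorProduct.smul_tmul', smul_smul, inv_mul_cancel₀ ht0, one_smul, ht] at this)
      (tmul_tmul_ne_zero (ha i) (hb i) (hc j))
    have hrest := hsum ({i, j} : Finset (Fin 5))ᶜ
    rw [Finset.card_compl, Finset.card_pair hij, Fintype.card_fin] at hrest
    have hsup := Submodule.finrank_add_le_finrank_add_finrank
      (({i, j} : Finset (Fin 5)).sup fun i => tripleTangent (K := K) (a i) (b i) (c i))
      (({i, j} : Finset (Fin 5))ᶜ.sup fun i => tripleTangent (K := K) (a i) (b i) (c i))
    rw [← Finset.sup_union, Finset.union_compl, Finset.sup_insert, Finset.sup_singleton] at hsup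
    have := h9 i
    have := h9 j
    omega
  obtain ⟨k, κ, hk, hκ⟩ := exists_pencil (a := a) hB hbs
  obtain ⟨l, μ, hl, hμ⟩ := exists_pencil (a := a) hC hcs
  by_cases hli : LinearIndependent K fun rs : Fin 2 × Fin 2 => tripleForm (k rs.1) (l rs.2)
  · have hann := Subspace.finrank_add_finrank_dualAnnihilator_eq
      (Finset.univ.sup fun i => tripleTangent (K := K) (a i) (b i) (c i))
    have hle : Submodule.span K (Set.range fun rs : Fin 2 × Fin 2 =>
        tripleForm (k rs.1) (l rs.2)) ≤
        (Finset.univ.sup fun i => tripleTangent (a i) (b i) (c i)).dualAnnihilator := by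
      rw [Finset.sup_univ_eq_iSup, Submodule.dualAnnihilator_iSup_eq, le_iInf_iff]
      intro i
      rw [Submodule.span_le]
      rintro _ ⟨rs, rfl⟩
      exact tripleForm_mem_dualAnnihilator (hk rs.1 i) (hl rs.2 i)
    have h4 := Submodule.finrank_mono hle
    rw [finrank_span_eq_card hli] at h4
    simp only [finrank_tensorProduct, hA, hB, hC, Fintype.card_prod, Fintype.card_fin] at hann h4
    omega
  · obtain ⟨i, β, γ, hβ, hγ, hi⟩ :=
      exists_hyperplanes_of_not_linearIndependent ha hcross hk hl hκ hμ hli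
    have hfour := finrank_sup_tripleTangent_le_of_forall_apply_eq_zero_both ({i}ᶜ : Finset (Fin 5))
      (a := a) (b := b) (c := c) hβ hγ (fun j hj => (hi j (by simpa using hj)).1)
      (fun j hj => (hi j (by simpa using hj)).2)
    rw [Finset.card_compl, Finset.card_singleton, Fintype.card_fin, hA, hB, hC] at hfour
    have hsup := Submodule.finrank_add_le_finrank_add_finrank
      (({i} : Finset (Fin 5)).sup fun i => tripleTangent (K := K) (a i) (b i) (c i))
      (({i} : Finset (Fin 5))ᶜ.sup fun i => tripleTangent (K := K) (a i) (b i) (c i))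
    rw [← Finset.sup_union, Finset.union_compl, Finset.sup_singleton] at hsup
    have := h9 i
    omega

end FivePoints

section Example

variable {K : Type*} [Field K]

/-- The first components of five points in general position. -/
def generalLeft (K : Type*) [Field K] : Fin 5 → Fin 3 → K :=
  ![![1, 0, 0], ![0, 1, 0], ![0, 0, 1], ![1, 1, 1], ![1, 2, 3]]

/-- The second and third components of five points in general position. -/
def generalRight (K : Type*) [Field K] : Fin 5 → Fin 4 → K :=
  ![![1, 0, 0, 0], ![0, 1, 0, 0], ![0, 0, 1, 0], ![0, 0, 0, 1], ![1, 1, 1, 1]]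

lemma generalLeft_ne_zero (i : Fin 5) : generalLeft K i ≠ 0 := by
  fin_cases i <;> simp [generalLeft]

lemma generalRight_ne_zero (i : Fin 5) : generalRight K i ≠ 0 := by
  fin_cases i <;> simp [generalRight]

lemma dual_tmul_tmul_eq_sum {m n p : ℕ}
    (D : Dual K ((Fin m → K) ⊗[K] ((Fin n → K) ⊗[K] (Fin p → K))))
    (a : Fin m → K) (b : Fin n → K) (c : Fin p → K) :
    D (a ⊗ₜ (b ⊗ₜ c)) = ∑ z, c z * ∑ y, b y * ∑ x, a x *
      D (Pi.single x 1 ⊗ₜ (Pi.single y 1 ⊗ₜ Pi.single z 1)) := by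
  have h {q : ℕ} (v : Fin q → K) : v = ∑ x, v x • Pi.single x (1 : K) := by
    ext j
    simp [Finset.sum_apply, Pi.single_apply]
  conv_lhs => rw [h a, h b, h c]
  simp only [TensorProduct.sum_tmul, TensorProduct.tmul_sum, TensorProduct.tmul_smul,
    ← TensorProduct.smul_tmul', map_sum, map_smul, smul_eq_mul]

lemma array_eq_zero (h2 : (2 : K) ≠ 0) {d : Fin 3 → Fin 4 → Fin 4 → K}
    (hx : ∀ i x, ∑ z, generalRight K i z * ∑ y, generalRight K i y * d x y z = 0)
    (hy : ∀ i y, ∑ z, generalRight K i z * ∑ x, generalLeft K i x * d x y z = 0)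
    (hz : ∀ i z, ∑ y, generalRight K i y * ∑ x, generalLeft K i x * d x y z = 0)
    (h210 : d 2 1 0 = 0) (h213 : d 2 1 3 = 0) (h230 : d 2 3 0 = 0) (h231 : d 2 3 1 = 0) :
    d = 0 := by
  simp only [Fin.forall_fin_succ, Fin.sum_univ_succ, generalLeft, generalRight] at hx hy hz
  simp at hx hy hz
  obtain ⟨⟨h000, h100, h200⟩, ⟨h011, h111, h211⟩, ⟨h022, h122, h222⟩, ⟨h033, h133, h233⟩,
    hx₀, hx₁, hx₂⟩ := hx
  obtain ⟨⟨-, h010, h020, h030⟩, ⟨h101, -, h121, h131⟩, ⟨h202, h212, -, h232⟩,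
    ⟨h3₀, h3₁, h3₂, -⟩, hy₀, hy₁, hy₂, hy₃⟩ := hy
  obtain ⟨⟨-, h001, h002, h003⟩, ⟨h110, -, h112, h113⟩, ⟨h220, h221, -, h223⟩,
    ⟨h3₀', h3₁', h3₂', -⟩, hz₀, hz₁, hz₂, -⟩ := hz
  simp only [h210, h213, h230, h231, h000, h100, h200, h011, h111, h211, h022, h122, h222, h033,
    h133, h233, h010, h020, h030, h101, h121, h131, h202, h212, h232, h001, h002, h003, h110,
    h112, h113, h220, h221, h223, add_zero, zero_add, mul_zero]
    at hx₀ hx₁ hx₂ hy₀ hy₁ hy₂ hy₃ hz₀ hz₁ hz₂ h3₀ h3₁ h3₂ h3₀' h3₁' h3₂'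
  have h012 : d 0 1 2 = 0 := by linear_combination hy₁ - h3₁
  have h132 : d 1 3 2 = 0 := by linear_combination hy₃ - h3₂' - h3₁' - 2 * h3₀'
  have h032 : d 0 3 2 = 0 := by linear_combination h3₂' - h132
  have h120 : d 1 2 0 = 0 := (mul_eq_zero.mp (by linear_combination hz₀ - 2 * h3₀' :
    2 * d 1 2 0 = 0)).resolve_left h2
  have h102 : d 1 0 2 = 0 := (mul_eq_zero.mp (by
    linear_combination hz₂ - h012 - h032 - 2 * h132 : 2 * d 1 0 2 = 0)).resolve_left h2
  have h103 : d 1 0 3 = 0 := (mul_eq_zero.mp (by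
    linear_combination hy₀ - 3 * hx₂ - 2 * h102 : 2 * d 1 0 3 = 0)).resolve_left h2
  have h203 : d 2 0 3 = 0 := by linear_combination h3₀ - h103
  have h201 : d 2 0 1 = 0 := by linear_combination hx₂ - h203
  have h021 : d 0 2 1 = 0 := by linear_combination hz₁ - h3₁' - 3 * h201
  have h023 : d 0 2 3 = 0 := by linear_combination hx₀ - h012 - h3₁ - h021 - h3₁' - h032
  have h123 : d 1 2 3 = 0 := by linear_combination h3₂ - h023
  ext x y z
  fin_cases x <;> fin_cases y <;> fin_cases z <;> assumption

/-- The five tangent spaces at points in general position span a space of dimension at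
least `44`. -/
lemma le_finrank_sup_tripleTangent_general (h2 : (2 : K) ≠ 0) :
    44 ≤ finrank K (Finset.univ.sup fun i =>
      tripleTangent (generalLeft K i) (generalRight K i) (generalRight K i) :
      Submodule K ((Fin 3 → K) ⊗[K] ((Fin 4 → K) ⊗[K] (Fin 4 → K)))) := by
  set S : Submodule K ((Fin 3 → K) ⊗[K] ((Fin 4 → K) ⊗[K] (Fin 4 → K))) :=
    Finset.univ.sup fun i => tripleTangent (generalLeft K i) (generalRight K i) (generalRight K i)
  let e (x : Fin 3) (y z : Fin 4) : (Fin 3 → K) ⊗[K] ((Fin 4 → K) ⊗[K] (Fin 4 → K)) :=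
    Pi.single x 1 ⊗ₜ (Pi.single y 1 ⊗ₜ Pi.single z 1)
  let φ : Dual K ((Fin 3 → K) ⊗[K] ((Fin 4 → K) ⊗[K] (Fin 4 → K))) →ₗ[K] Fin 4 → K :=
    LinearMap.pi ![Dual.eval K _ (e 2 1 0), Dual.eval K _ (e 2 1 3), Dual.eval K _ (e 2 3 0),
      Dual.eval K _ (e 2 3 1)]
  have hφ : S.dualAnnihilator ⊓ LinearMap.ker φ = ⊥ := by
    refine (Submodule.eq_bot_iff _).mpr ?_
    rintro D ⟨hD, h⟩
    replace h : φ D = 0 := h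
    replace hD : ∀ w ∈ S, D w = 0 := (Submodule.mem_dualAnnihilator D).mp hD
    have hle : ∀ i, tripleTangent (generalLeft K i) (generalRight K i) (generalRight K i) ≤ S :=
      fun i => Finset.le_sup (f := fun i =>
        tripleTangent (K := K) (generalLeft K i) (generalRight K i) (generalRight K i))
        (Finset.mem_univ i)
    have hd : (fun x y z => D (e x y z)) = 0 := by
      refine array_eq_zero h2 (fun i x => ?_) (fun i y => ?_) (fun i z => ?_)
        (congrFun h 0) (congrFun h 1) (congrFun h 2) (congrFun h 3)
      · have := hD _ (hle i (tmul_mem_tripleTangent_left _ _ _ (Pi.single x 1)))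
        rw [dual_tmul_tmul_eq_sum] at this
        simpa [Pi.single_apply] using this
      · have := hD _ (hle i (tmul_mem_tripleTangent_mid _ _ _ (Pi.single y 1)))
        rw [dual_tmul_tmul_eq_sum] at this
        simpa [Pi.single_apply] using this
      · have := hD _ (hle i (tmul_mem_tripleTangent_right _ _ _ (Pi.single z 1)))
        rw [dual_tmul_tmul_eq_sum] at this
        simpa [Pi.single_apply] using this
    ext x y z
    exact congrFun (congrFun (congrFun hd x) y) z
  have h₁ := finrank_le_finrank_map_add_finrank_inf_ker φ S.dualAnnihilator
  have h₂ := Subspace.finrank_add_finrank_dualAnnihilator_eq S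
  have h₃ := (S.dualAnnihilator.map φ).finrank_le
  rw [hφ, finrank_bot] at h₁
  simp only [finrank_tensorProduct, finrank_pi, Fintype.card_fin] at h₂ h₃
  omega

end Example

section ThreeFactors

/-- Dependent functions on `Fin 3` as triples. -/
def piFinThreeEquivProd (κ : Fin 3 → Type*) : (∀ i, κ i) ≃ κ 0 × κ 1 × κ 2 where
  toFun p := (p 0, p 1, p 2)
  invFun q := Fin.cons q.1 (Fin.cons q.2.1 (Fin.cons q.2.2 finZeroElim))
  left_inv p := by
    ext i
    fin_cases i <;> rfl
  right_inv _ := rfl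

lemma piFinThreeEquivProd_symm_zero {κ : Fin 3 → Type*} (q : κ 0 × κ 1 × κ 2) :
    (piFinThreeEquivProd κ).symm q 0 = q.1 := rfl

lemma piFinThreeEquivProd_symm_one {κ : Fin 3 → Type*} (q : κ 0 × κ 1 × κ 2) :
    (piFinThreeEquivProd κ).symm q 1 = q.2.1 := rfl

lemma piFinThreeEquivProd_symm_two {κ : Fin 3 → Type*} (q : κ 0 × κ 1 × κ 2) :
    (piFinThreeEquivProd κ).symm q 2 = q.2.2 := rfl

variable {K : Type*} [Field K] {M : Fin 3 → Type*} [∀ i, AddCommGroup (M i)]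
  [∀ i, Module K (M i)] [∀ i, FiniteDimensional K (M i)]

/-- The tensor product of a family indexed by `Fin 3` as an iterated binary tensor product. -/
noncomputable def piTensorFinThreeEquiv (M : Fin 3 → Type*) [∀ i, AddCommGroup (M i)]
    [∀ i, Module K (M i)] [∀ i, FiniteDimensional K (M i)] :
    (⨂[K] i, M i) ≃ₗ[K] M 0 ⊗[K] (M 1 ⊗[K] M 2) :=
  (Basis.piTensorProduct fun i => finBasis K (M i)).repr ≪≫ₗ
    Finsupp.domLCongr (piFinThreeEquivProd fun i => Fin (finrank K (M i))) ≪≫ₗ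
    ((finBasis K (M 0)).tensorProduct
      ((finBasis K (M 1)).tensorProduct (finBasis K (M 2)))).repr.symm

@[simp]
lemma piTensorFinThreeEquiv_tprod (v : ∀ i, M i) :
    piTensorFinThreeEquiv (K := K) M (PiTensorProduct.tprod K v) = v 0 ⊗ₜ (v 1 ⊗ₜ v 2) := by
  refine Basis.ext_elem
    ((finBasis K (M 0)).tensorProduct ((finBasis K (M 1)).tensorProduct (finBasis K (M 2))))
    fun ⟨x, y, z⟩ => ?_
  simp only [piTensorFinThreeEquiv, LinearEquiv.trans_apply, LinearEquiv.apply_symm_apply,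
    Finsupp.domLCongr_apply, Finsupp.domCongr_apply, Finsupp.equivMapDomain_apply,
    Basis.piTensorProduct_repr_tprod_apply, Basis.tensorProduct_repr_tmul_apply,
    Fin.prod_univ_three, smul_eq_mul, piFinThreeEquivProd_symm_zero,
    piFinThreeEquivProd_symm_one, piFinThreeEquivProd_symm_two]
  ring

lemma map_piTensorFinThreeEquiv_iSup_range (v : ∀ i, M i) :
    (⨆ i, LinearMap.range ((PiTensorProduct.tprod K).toLinearMap v i)).map
      (piTensorFinThreeEquiv (K := K) M).toLinearMap = tripleTangent (v 0) (v 1) (v 2) := by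
  refine le_antisymm ?_ ?_
  · rw [Submodule.map_le_iff_le_comap, iSup_le_iff]
    rintro i _ ⟨x, rfl⟩
    have h := tripleTangent_le_iff (K := K).mp (le_refl (tripleTangent (v 0) (v 1) (v 2)))
    fin_cases i
    · simpa using h.1 x
    · simpa using h.2.1 x
    · simpa using h.2.2 x
  · have h (i : Fin 3) (x : M i) : piTensorFinThreeEquiv (K := K) M
        (PiTensorProduct.tprod K (Function.update v i x)) ∈
        (⨆ i, LinearMap.range ((PiTensorProduct.tprod K).toLinearMap v i)).map
          (piTensorFinThreeEquiv (K := K) M).toLinearMap :=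
      Submodule.mem_map_of_mem (Submodule.mem_iSup_of_mem i ⟨x, rfl⟩)
    exact tripleTangent_le_iff.mpr ⟨fun x => by simpa using h 0 x, fun x => by simpa using h 1 x,
      fun x => by simpa using h 2 x⟩

lemma finrank_iSup_iSup_range_toLinearMap {ι : Type*} (v : ι → ∀ i, M i) :
    finrank K (⨆ j, ⨆ i, LinearMap.range ((PiTensorProduct.tprod K).toLinearMap (v j) i) :
      Submodule K (⨂[K] i, M i)) =
    finrank K (⨆ j, tripleTangent (v j 0) (v j 1) (v j 2) :
      Submodule K (M 0 ⊗[K] (M 1 ⊗[K] M 2))) := by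
  have h : ⨆ j, tripleTangent (v j 0) (v j 1) (v j 2) =
      (⨆ j, ⨆ i, LinearMap.range ((PiTensorProduct.tprod K).toLinearMap (v j) i)).map
        (piTensorFinThreeEquiv (K := K) M).toLinearMap := by
    rw [Submodule.map_iSup]
    exact iSup_congr fun j => (map_piTensorFinThreeEquiv_iSup_range (v j)).symm
  rw [h]
  exact (LinearEquiv.finrank_map_eq _ _).symm

end ThreeFactors

section Segre

variable (K : Type*) [Field K]

lemma finrank_iSup_segreTangent {ι : Type*} (p : ι → ∀ i, Fin (![2, 3, 3] i + 1) → K) :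
    finrank K (⨆ j, segreTangent K ![2, 3, 3] (p j) :
      Submodule K (⨂[K] i, (Fin (![2, 3, 3] i + 1) → K))) =
    finrank K (⨆ j, tripleTangent (p j 0) (p j 1) (p j 2) :
      Submodule K ((Fin 3 → K) ⊗[K] ((Fin 4 → K) ⊗[K] (Fin 4 → K)))) :=
  finrank_iSup_iSup_range_toLinearMap p

lemma finrank_iSup_segreTangent_le (p : Fin 5 → ∀ i, Fin (![2, 3, 3] i + 1) → K)
    (hp : ∀ j i, p j i ≠ 0) :
    finrank K (⨆ j, segreTangent K ![2, 3, 3] (p j) :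
      Submodule K (⨂[K] i, (Fin (![2, 3, 3] i + 1) → K))) ≤ 44 := by
  rw [finrank_iSup_segreTangent, ← Finset.sup_univ_eq_iSup]
  exact finrank_sup_tripleTangent_le (by simp) (by simp) (hp · 0) (hp · 1) (hp · 2)

/-- Five points of `P² × P³ × P³` in general position. -/
def generalPoint (j : Fin 5) : ∀ i, Fin (![2, 3, 3] i + 1) → K
  | 0 => generalLeft K j
  | 1 => generalRight K j
  | 2 => generalRight K j

lemma generalPoint_ne_zero (j : Fin 5) : ∀ i, generalPoint K j i ≠ 0
  | 0 => generalLeft_ne_zero j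
  | 1 => generalRight_ne_zero j
  | 2 => generalRight_ne_zero j

lemma le_finrank_iSup_segreTangent_generalPoint (h2 : (2 : K) ≠ 0) :
    44 ≤ finrank K (⨆ j, segreTangent K ![2, 3, 3] (generalPoint K j) :
      Submodule K (⨂[K] i, (Fin (![2, 3, 3] i + 1) → K))) := by
  rw [finrank_iSup_segreTangent, ← Finset.sup_univ_eq_iSup]
  exact le_finrank_sup_tripleTangent_general h2

end Segre

end Secant

/-- For `X = P² × P³ × P³`, the 5-secant variety has dimension exactly
`43`: for every choice of 5 points the span of the tangent spaces has dimension at most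
`44`, this bound is attained, and in particular `T(2,3,3; 5; 0,0,0)` fails (the expected
value being `min (5·9) 48 = 45`). -/
theorem P2P3P3_secant5
    (K : Type*) [Field K] [CharZero K] :
    (∀ p : Fin 5 → ∀ i, Fin (![2, 3, 3] i + 1) → K,
      (∀ j i, p j i ≠ 0) →
      Module.finrank K ((⨆ j, segreTangent K ![2, 3, 3] (p j))
          : Submodule K (⨂[K] i, (Fin (![2, 3, 3] i + 1) → K))) ≤ 44) ∧
    (∃ p : Fin 5 → ∀ i, Fin (![2, 3, 3] i + 1) → K,
      (∀ j i, p j i ≠ 0) ∧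
      Module.finrank K ((⨆ j, segreTangent K ![2, 3, 3] (p j))
          : Submodule K (⨂[K] i, (Fin (![2, 3, 3] i + 1) → K))) = 44) ∧
    TFails K ![2, 3, 3] 5 (fun _ => 0) := by
  refine ⟨finrank_iSup_segreTangent_le K, ⟨generalPoint K, generalPoint_ne_zero K, le_antisymm
    (finrank_iSup_segreTangent_le K _ (generalPoint_ne_zero K))
    (le_finrank_iSup_segreTangent_generalPoint K two_ne_zero)⟩, fun p q hp _ => ?_⟩
  have hexp : min (5 * (1 + ∑ i, ![2, 3, 3] i) + ∑ i : Fin 3, 0 * (![2, 3, 3] i + 1))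
      (∏ i, (![2, 3, 3] i + 1)) = 45 := by decide
  have hbot : (⨆ i, ⨆ l : Fin 0, segreG K ![2, 3, 3] (q i l) i) = ⊥ := by simp
  rw [hexp, hbot, sup_bot_eq]
  exact Nat.lt_succ_of_le (finrank_iSup_segreTangent_le K p hp)
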